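/- Fix α ∈ (0,1] and set a = exp(−(Ω+1))/2 and K = exp(4(Ω+1)). Then: (1) for every B > 0, every ψ ∈ ℋ_B, and every integer n ≥ log(B)/(α·log λ), one has Lⁿψ ∈ ℋ_{Ω+1}; (2) every ψ ∈ ℋ_{Ω+1} satisfies ψ(x) ≥ 2a for all x ∈ S¹; (3) for every ψ ∈ ℋ_{Ω+1}, the function (ψ − a)/(1 − a) belongs to ℋ_K. -/

import Mathlib

open MeasureTheory Real


/-- `holderBound α f H` asserts that `H` is an upper bound for the `α`-Hölder
constant of `f`, i.e. `|f x - f y| ≤ H · d(x,y)^α` for all `x, y`. -/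
def holderBound (α : ℝ) (f : UnitAddCircle → ℝ) (H : ℝ) : Prop :=
  ∀ x y : UnitAddCircle, |f x - f y| ≤ H * dist x y ^ α


/-- `memH α D ψ` : ψ is a strictly positive probability density on the circle
with `H_α(log ψ) ≤ D` (the class `ℋ_D`). -/
def memH (α D : ℝ) (ψ : UnitAddCircle → ℝ) : Prop :=
  (∀ x, 0 < ψ x) ∧ (∫ x, ψ x = 1) ∧ holderBound α (fun x => Real.log (ψ x)) D

lemma cp_coe_eq {x y : ℝ} (h : (x : UnitAddCircle) = (y : UnitAddCircle)) :
    ∃ m : ℤ, x = y + m := by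
  have h2 : ((x - y : ℝ) : UnitAddCircle) = 0 := by
    rw [AddCircle.coe_sub, h, sub_self]
  obtain ⟨n, hn⟩ := (AddCircle.coe_eq_zero_iff (1:ℝ)).1 h2
  refine ⟨n, ?_⟩
  simp at hn
  linarith

lemma cp_coe_int (x : ℝ) (m : ℤ) : ((x + m : ℝ) : UnitAddCircle) = (x : UnitAddCircle) := by
  have : ((m : ℝ) : UnitAddCircle) = 0 := (AddCircle.coe_eq_zero_iff (1:ℝ)).2 ⟨m, by simp⟩
  rw [AddCircle.coe_add, this, add_zero]

lemma cp_dist_le (x y : ℝ) : dist (x : UnitAddCircle) (y : UnitAddCircle) ≤ |x - y| := by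
  rw [dist_eq_norm, ← AddCircle.coe_sub, UnitAddCircle.norm_eq]
  simpa using round_le (x - y) 0

lemma cp_lift (x y : UnitAddCircle) :
    ∃ s t : ℝ, (s : UnitAddCircle) = x ∧ (t : UnitAddCircle) = y ∧ |s - t| = dist x y := by
  obtain ⟨s, rfl⟩ := QuotientAddGroup.mk_surjective x
  obtain ⟨t, rfl⟩ := QuotientAddGroup.mk_surjective y
  refine ⟨s, t + round (s - t), rfl, cp_coe_int _ _, ?_⟩
  change _ = dist (s : UnitAddCircle) (t : UnitAddCircle)
  rw [dist_eq_norm, ← AddCircle.coe_sub, UnitAddCircle.norm_eq]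
  congr 1
  ring

lemma cp_dist_le_half (x y : UnitAddCircle) : dist x y ≤ 1 / 2 := by
  rw [dist_eq_norm]
  simpa using AddCircle.norm_le_half_period (1:ℝ) (x := x - y) one_ne_zero

lemma cp_dist_rpow_le_one {α : ℝ} (hα : 0 < α) (x y : UnitAddCircle) : dist x y ^ α ≤ 1 :=
  Real.rpow_le_one dist_nonneg (by linarith [cp_dist_le_half x y]) hα.le

lemma cp_dist_le_rpow {α : ℝ} (hα : 0 < α) (hα1 : α ≤ 1) (x y : UnitAddCircle) :
    dist x y ≤ dist x y ^ α := by
  rcases eq_or_lt_of_le (dist_nonneg (x := x) (y := y)) with h | h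
  · rw [← h, Real.zero_rpow hα.ne']
  · have := Real.rpow_le_rpow_of_exponent_ge h (by linarith [cp_dist_le_half x y]) hα1
    simpa using this

lemma cp_cont {α D : ℝ} (hα : 0 < α) {ψ : UnitAddCircle → ℝ} (hpos : ∀ x, 0 < ψ x)
    (h : holderBound α (fun x => Real.log (ψ x)) D) : Continuous ψ := by
  have hl : Continuous (fun x => Real.log (ψ x)) := by
    rw [continuous_iff_continuousAt]
    intro y
    rw [ContinuousAt, tendsto_iff_dist_tendsto_zero]
    have hz : Filter.Tendsto (fun x : UnitAddCircle => D * dist x y ^ α) (nhds y) (nhds 0) := by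
      have hc : Continuous (fun x : UnitAddCircle => D * dist x y ^ α) :=
        continuous_const.mul
          ((continuous_id.dist continuous_const).rpow_const (fun _ => Or.inr hα.le))
      have := hc.tendsto y
      simpa [Real.zero_rpow hα.ne'] using this
    exact squeeze_zero (fun _ => dist_nonneg) (fun x => h x y) hz
  have : ψ = fun x => Real.exp (Real.log (ψ x)) := by
    funext x; rw [Real.exp_log (hpos x)]
  rw [this]
  exact Real.continuous_exp.comp hl

lemma cp_int {ψ : UnitAddCircle → ℝ} (h : Continuous ψ) : Integrable ψ :=
  h.integrable_of_hasCompactSupport (HasCompactSupport.of_compactSpace ψ)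

lemma cp_exists_ge_one {ψ : UnitAddCircle → ℝ} (h : Continuous ψ) (h1 : ∫ x, ψ x = 1) :
    ∃ y, 1 ≤ ψ y := by
  by_contra! hlt
  obtain ⟨y, -, hy⟩ := isCompact_univ.exists_isMaxOn (Set.univ_nonempty) h.continuousOn
  have : ∫ x, ψ x ≤ ∫ _x : UnitAddCircle, ψ y :=
    integral_mono (cp_int h) (integrable_const _) (fun x => hy (Set.mem_univ x))
  rw [h1] at this
  simp [measureReal_def] at this
  linarith [hlt y]

lemma cp_lower {α C : ℝ} (hα : 0 < α) (hC : 0 ≤ C) {ψ : UnitAddCircle → ℝ} (h : memH α C ψ)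
    (x : UnitAddCircle) : Real.exp (-C) ≤ ψ x := by
  obtain ⟨hp, h1, hh⟩ := h
  obtain ⟨y, hy⟩ := cp_exists_ge_one (cp_cont hα hp hh) h1
  have h2 := hh x y
  have h3 := cp_dist_rpow_le_one hα x y
  have h4 : C * dist x y ^ α ≤ C := by nlinarith
  have h5 := Real.log_nonneg hy
  have h6 := (abs_le.1 h2).1
  rw [← Real.exp_log (hp x)]
  apply Real.exp_le_exp.2
  simp only at h6
  linarith

lemma cp_logsub {a p q : ℝ} (ha : 0 < a) (hq : 2 * a ≤ q) (hpq : q ≤ p) :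
    Real.log (p - a) - Real.log (q - a) ≤ 2 * (Real.log p - Real.log q) := by
  have hq0 : 0 < q := by linarith
  have hp0 : 0 < p := by linarith
  have e : 2 * (Real.log p - Real.log q) = Real.log (p^2/q^2) := by
    rw [Real.log_div (by positivity) (by positivity), Real.log_pow, Real.log_pow]; push_cast; ring
  rw [e, ← Real.log_div (by linarith) (by linarith)]
  apply Real.log_le_log (div_pos (by linarith) (by linarith))
  rw [div_le_div_iff₀ (by linarith) (by positivity)]
  have : 0 ≤ (p - q) * (p * q - a * (p + q)) := by
    apply mul_nonneg (by linarith)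
    nlinarith
  nlinarith

lemma cp_part3 {α C a K : ℝ} (hα : 0 < α) (hC : 0 ≤ C) (ha : a = Real.exp (-C) / 2)
    (hK : 2 * C ≤ K) {ψ : UnitAddCircle → ℝ} (h : memH α C ψ) :
    memH α K (fun x => (ψ x - a) / (1 - a)) := by
  have hlow := cp_lower hα hC h
  have ha0 : 0 < a := by rw [ha]; positivity
  have ha1 : a ≤ 1 / 2 := by
    have : Real.exp (-C) ≤ 1 := Real.exp_le_one_iff.2 (by linarith)
    linarith
  have hl : ∀ x, 2 * a ≤ ψ x := fun x => by have := hlow x; linarith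
  obtain ⟨hp, h1, hh⟩ := h
  have key : ∀ x y, Real.log ((ψ x - a) / (1 - a)) - Real.log ((ψ y - a) / (1 - a))
      ≤ K * dist x y ^ α := by
    intro x y
    rw [Real.log_div (by linarith [hl x]) (by linarith), Real.log_div (by linarith [hl y]) (by linarith)]
    have hd : 0 ≤ dist x y ^ α := Real.rpow_nonneg dist_nonneg _
    have hb : Real.log (ψ x) - Real.log (ψ y) ≤ C * dist x y ^ α := (abs_le.1 (hh x y)).2
    rcases le_total (ψ y) (ψ x) with hxy | hxy
    · have := cp_logsub ha0 (hl y) hxy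
      nlinarith
    · have : Real.log (ψ x - a) ≤ Real.log (ψ y - a) :=
        Real.log_le_log (by linarith [hl x]) (by linarith)
      have : 0 ≤ K * dist x y ^ α := mul_nonneg (by linarith) hd
      linarith
  refine ⟨fun x => div_pos (by linarith [hl x]) (by linarith), ?_, fun x y => ?_⟩
  · rw [integral_div, integral_sub (cp_int (cp_cont hα hp hh)) (integrable_const _), h1]
    simp [measureReal_def]
    intro h0; linarith
  · rw [abs_le]
    have h2 := key x y
    have h3 := key y x
    rw [dist_comm y x] at h3
    constructor <;> simp only <;> linarith

lemma cp_step
    (F : ℝ → ℝ) (hF : ContDiff ℝ 2 F)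
    (w : ℕ) (hw : 0 < w) (hFw : ∀ x : ℝ, F (x + 1) = F x + w)
    (T : UnitAddCircle → UnitAddCircle) (hT : ∀ x : ℝ, T ↑x = (↑(F x) : UnitAddCircle))
    (lam : ℝ) (hlam : 1 < lam) (hexp : ∀ x : ℝ, lam ≤ deriv F x)
    (T' : UnitAddCircle → ℝ) (hT'lift : ∀ x : ℝ, T' ↑x = deriv F x) :
    ∃ G : ℝ → ℝ, (∀ x, F (G x) = x) ∧ (∀ x, G (F x) = x) ∧ Continuous G ∧
      (∀ x y, |G x - G y| ≤ |x - y| / lam) ∧ G w = G 0 + 1 ∧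
      ∀ u : UnitAddCircle → ℝ, ∀ x : ℝ, ∑' y : (T ⁻¹' {(x : UnitAddCircle)}), u y / T' y
        = ∑ k ∈ Finset.range w, u ↑(G (x + k)) / deriv F (G (x + k)) := by
  have hd : Differentiable ℝ F := hF.differentiable (by norm_num)
  have hl0 : 0 < lam := by linarith
  have hmv : ∀ x y, x ≤ y → lam * (y - x) ≤ F y - F x := fun x y hxy =>
    mul_sub_le_image_sub_of_le_deriv hd hexp hxy
  have hmono : StrictMono F := strictMono_of_deriv_pos (fun x => by linarith [hexp x])
  have hsurj : Function.Surjective F := by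
    apply hd.continuous.surjective
    · refine Filter.tendsto_atTop_mono' Filter.atTop (f₁ := fun x => lam * x + F 0) ?_ ?_
      · filter_upwards [Filter.eventually_ge_atTop 0] with x hx
        have := hmv 0 x hx
        linarith
      · exact Filter.tendsto_atTop_add_const_right _ _ (Filter.tendsto_id.const_mul_atTop hl0)
    · refine Filter.tendsto_atBot_mono' Filter.atBot (f₁ := fun x => lam * x + F 0) ?_ ?_
      · filter_upwards [Filter.eventually_le_atBot 0] with x hx
        have := hmv x 0 hx
        linarith
      · exact Filter.tendsto_atBot_add_const_right _ _ (Filter.tendsto_id.const_mul_atBot hl0)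
  choose G hG using hsurj
  have hGF : ∀ x, G (F x) = x := fun x => hmono.injective (hG _)
  have hFz : ∀ (x : ℝ) (m : ℤ), F (x + m) = F x + m * w := by
    intro x m
    induction m using Int.induction_on with
    | zero => simp
    | succ n ih =>
      have := hFw (x + (n:ℤ))
      push_cast at *
      rw [← add_assoc, this, ih]; ring
    | pred n ih =>
      have := hFw (x + ((-(n:ℤ) - 1 : ℤ) : ℝ))
      push_cast at *
      rw [show x + (-(n:ℝ) - 1) + 1 = x + -n by ring, ih] at this
      linarith
  have habs : ∀ x y, |G x - G y| ≤ |x - y| / lam := by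
    intro x y
    rw [le_div_iff₀ hl0]
    rcases le_total (G x) (G y) with h | h
    · have := hmv _ _ h
      rw [hG, hG] at this
      rw [abs_sub_comm, abs_of_nonneg (by linarith), abs_sub_comm]
      exact le_trans (by linarith) (le_abs_self _)
    · have := hmv _ _ h
      rw [hG, hG] at this
      rw [abs_of_nonneg (by linarith)]
      exact le_trans (by linarith) (le_abs_self _)
  refine ⟨G, hG, hGF, ?_, habs, ?_, ?_⟩
  · have : LipschitzWith (Real.toNNReal (1/lam)) G := by
      apply LipschitzWith.of_dist_le_mul
      intro x y
      rw [Real.dist_eq, Real.dist_eq, Real.coe_toNNReal _ (by positivity)]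
      have := habs x y
      rw [div_eq_mul_inv] at this
      rw [one_div]; linarith
    exact this.continuous
  · apply hmono.injective
    rw [hG, hFw, hG]; simp
  · intro u x
    let e : Fin w → (T ⁻¹' {(x : UnitAddCircle)}) := fun k => ⟨(G (x + (k:ℕ)) : UnitAddCircle), by
      change T _ = _
      rw [hT, hG]
      exact cp_coe_int x ((k:ℕ):ℤ)⟩
    have he : Function.Bijective e := by
      constructor
      · intro k l hkl
        have h1 : ((G (x + (k:ℕ)) : ℝ) : UnitAddCircle) = (G (x + (l:ℕ)) : ℝ) :=
          congrArg Subtype.val hkl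
        obtain ⟨m, hm⟩ := cp_coe_eq h1
        have h2 := congrArg F hm
        rw [hFz, hG, hG] at h2
        have h3 : ((k:ℕ):ℤ) = (l:ℕ) + m * w := by
          have : ((k:ℕ):ℝ) = (l:ℕ) + m * w := by linarith
          exact_mod_cast this
        have hk : ((k:ℕ):ℤ) < w := by exact_mod_cast k.2
        have hl : ((l:ℕ):ℤ) < w := by exact_mod_cast l.2
        have h4 : ((k:ℕ):ℤ) % w = ((l:ℕ):ℤ) % w := by rw [h3]; simp
        rw [Int.emod_eq_of_lt (by positivity) hk, Int.emod_eq_of_lt (by positivity) hl] at h4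
        exact Fin.ext (by exact_mod_cast h4)
      · rintro ⟨y, hy⟩
        obtain ⟨s, rfl⟩ := QuotientAddGroup.mk_surjective y
        have hy' : T (s : UnitAddCircle) = x := hy
        rw [hT] at hy'
        obtain ⟨j, hj⟩ := cp_coe_eq hy'
        have hw' : (0:ℤ) < w := by exact_mod_cast hw
        have hj0 := Int.emod_nonneg j hw'.ne'
        have hj1 := Int.emod_lt_of_pos j hw'
        have hcast : (((j % w).toNat : ℕ) : ℤ) = j % w := Int.toNat_of_nonneg hj0
        refine ⟨⟨(j % w).toNat, by omega⟩, Subtype.ext ?_⟩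
        change ((G (x + ((j % w).toNat : ℕ)) : ℝ) : UnitAddCircle) = (s : UnitAddCircle)
        have hR : (((j % w).toNat : ℕ) : ℝ) = j - (j / w : ℤ) * w := by
          have : (((j % w).toNat : ℕ) : ℤ) = j - (j / w) * w := by
            rw [hcast]; have := Int.emod_add_mul_ediv j w; linarith
          exact_mod_cast this
        have h5 : G (x + ((j % w).toNat : ℕ)) = s + ((-(j / w) : ℤ) : ℝ) := by
          apply hmono.injective
          rw [hG, hFz, hj, hR]; push_cast; ring
        rw [h5]
        exact cp_coe_int _ _
    rw [← (Equiv.ofBijective e he).tsum_eq, tsum_fintype,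
      ← Fin.sum_univ_eq_sum_range (fun k : ℕ => u ↑(G (x + k)) / deriv F (G (x + k)))]
    refine Finset.sum_congr rfl (fun k _ => ?_)
    change u (G (x + (k:ℕ)) : ℝ) / T' (G (x + (k:ℕ)) : ℝ) = _
    rw [hT'lift]

lemma cp_bound (F : ℝ → ℝ) (hF : ContDiff ℝ 2 F) (w : ℕ)
    (hFw : ∀ x : ℝ, F (x + 1) = F x + w) (x : ℝ) :
    |deriv (deriv F) x| ≤ ⨆ x : ℝ, |deriv (deriv F) x| := by
  have hp1 : ∀ x, deriv F (x + 1) = deriv F x := by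
    intro x
    rw [← deriv_comp_add_const]
    simp only [hFw]
    simp
  have hp2 : ∀ x, deriv (deriv F) (x + 1) = deriv (deriv F) x := by
    intro x
    rw [← deriv_comp_add_const]
    simp only [hp1]
  have hc : Continuous (deriv (deriv F)) := by
    have h1 : ContDiff ℝ 1 (deriv F) := by
      have : ContDiff ℝ (1 + 1) F := by norm_num; exact hF
      exact (contDiff_succ_iff_deriv.1 this).2.2
    exact h1.continuous_deriv le_rfl
  have hper : Function.Periodic (fun x => |deriv (deriv F) x|) 1 := fun x => by
    simp only [hp2]
  exact le_ciSup (hper.compact_of_continuous one_ne_zero hc.abs).bddAbove x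

lemma cp_loglip (F : ℝ → ℝ) (hF : ContDiff ℝ 2 F) (lam M : ℝ) (hlam : 1 < lam)
    (hexp : ∀ x : ℝ, lam ≤ deriv F x) (hM : ∀ x, |deriv (deriv F) x| ≤ M) (s t : ℝ) :
    |Real.log (deriv F s) - Real.log (deriv F t)| ≤ M / lam * |s - t| := by
  have h1 : ContDiff ℝ 1 (deriv F) := by
    have : ContDiff ℝ (1 + 1) F := by norm_num; exact hF
    exact (contDiff_succ_iff_deriv.1 this).2.2
  have hd : Differentiable ℝ (deriv F) := h1.differentiable (by norm_num)
  have hpos : ∀ x, 0 < deriv F x := fun x => by linarith [hexp x]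
  have hdl : ∀ x, HasDerivAt (fun x => Real.log (deriv F x)) (deriv (deriv F) x / deriv F x) x :=
    fun x => (hd x).hasDerivAt.log (hpos x).ne'
  have hM0 : 0 ≤ M := (abs_nonneg _).trans (hM 0)
  have := Convex.norm_image_sub_le_of_norm_hasDerivWithin_le (s := Set.univ) (x := t) (y := s)
    (C := M / lam) (fun x _ => (hdl x).hasDerivWithinAt) (fun x _ => by
      rw [Real.norm_eq_abs, abs_div, abs_of_pos (hpos x)]
      exact div_le_div₀ hM0 (hM x) (by linarith) (hexp x)) convex_univ trivial trivial
  simpa [Real.norm_eq_abs] using this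

/-- Two-parameter regularity class. -/
def cpMem (α P Q : ℝ) (ψ : UnitAddCircle → ℝ) : Prop :=
  (∀ x, 0 < ψ x) ∧ (∫ x, ψ x = 1) ∧
    ∀ x y, |Real.log (ψ x) - Real.log (ψ y)| ≤ P * dist x y ^ α + Q * dist x y

lemma cpMem_memH {α P Q C : ℝ} (hα : 0 < α) (hα1 : α ≤ 1) (hQ : 0 ≤ Q) (hC : P + Q ≤ C)
    {ψ : UnitAddCircle → ℝ} (h : cpMem α P Q ψ) : memH α C ψ := by
  refine ⟨h.1, h.2.1, fun x y => (h.2.2 x y).trans ?_⟩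
  have h1 := cp_dist_le_rpow hα hα1 x y
  have h2 : 0 ≤ dist x y ^ α := Real.rpow_nonneg dist_nonneg _
  nlinarith

lemma cp_L
    (F : ℝ → ℝ) (hF : ContDiff ℝ 2 F)
    (w : ℕ) (hw : 0 < w) (lam : ℝ) (hlam : 1 < lam) (hexp : ∀ x : ℝ, lam ≤ deriv F x)
    (M : ℝ) (hM : ∀ x, |deriv (deriv F) x| ≤ M)
    (G : ℝ → ℝ) (hG : ∀ x, F (G x) = x) (hGF : ∀ x, G (F x) = x) (hGc : Continuous G)
    (hGl : ∀ x y, |G x - G y| ≤ |x - y| / lam) (hGw : G w = G 0 + 1)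
    (α : ℝ) (hα : 0 < α) (hα1 : α ≤ 1) (P Q : ℝ) (hP : 0 ≤ P) (hQ : 0 ≤ Q)
    (ψ φ : UnitAddCircle → ℝ)
    (hφ : ∀ x : ℝ, φ x = ∑ k ∈ Finset.range w, ψ ↑(G (x + k)) / deriv F (G (x + k)))
    (h : cpMem α P Q ψ) :
    cpMem α (P * lam ^ (-α)) (Q / lam + M / lam ^ 2) φ := by
  have hl0 : 0 < lam := by linarith
  have hpos : ∀ x, 0 < deriv F x := fun x => by linarith [hexp x]
  have hcψ : Continuous ψ := by
    obtain ⟨a, b, c⟩ := cpMem_memH hα hα1 hQ le_rfl h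
    exact cp_cont hα a c
  have hd : Differentiable ℝ F := hF.differentiable (by norm_num)
  have hcF' : Continuous (deriv F) := hF.continuous_deriv (by norm_num)
  obtain ⟨hp, h1, hh⟩ := h
  have hM0 : 0 ≤ M := (abs_nonneg _).trans (hM 0)
  have hφp : ∀ x, 0 < φ x := by
    intro x
    obtain ⟨s, rfl⟩ := QuotientAddGroup.mk_surjective x
    change 0 < φ (s : UnitAddCircle)
    rw [hφ]
    exact Finset.sum_pos (fun k _ => div_pos (hp _) (hpos _)) ⟨0, Finset.mem_range.2 hw⟩
  refine ⟨hφp, ?_, ?_⟩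
  · rw [← UnitAddCircle.intervalIntegral_preimage 0 φ]
    simp only [hφ]
    set g : ℝ → ℝ := fun t => ψ ↑(G t) / deriv F (G t) with hg
    have hgc : Continuous g := by
      apply Continuous.div
      · exact hcψ.comp ((AddCircle.continuous_mk' (1:ℝ)).comp hGc)
      · exact hcF'.comp hGc
      · exact fun x => (hpos _).ne'
    have hii : ∀ a b, IntervalIntegrable g volume a b := fun a b => hgc.intervalIntegrable a b
    change ∫ x in (0:ℝ)..0+1, ∑ k ∈ Finset.range w, g (x + k) = 1
    have hgk : ∀ k ∈ Finset.range w,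
        IntervalIntegrable (fun x : ℝ => g (x + (k:ℝ))) volume 0 (0 + 1) := fun k _ =>
      (hgc.comp (continuous_id.add continuous_const)).intervalIntegrable _ _
    rw [intervalIntegral.integral_finsetSum hgk]
    have e1 : ∀ k ∈ Finset.range w, ∫ x in (0:ℝ)..0+1, g (x + k)
        = ∫ x in ((k:ℕ):ℝ)..((k+1:ℕ):ℝ), g x := by
      intro k _
      rw [intervalIntegral.integral_comp_add_right]
      congr 1 <;> push_cast <;> ring
    rw [Finset.sum_congr rfl e1,
      intervalIntegral.sum_integral_adjacent_intervals (a := fun k : ℕ => (k:ℝ)) (fun k _ => hii _ _)]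
    have e2 := intervalIntegral.integral_comp_mul_deriv (a := G 0) (b := G w) (f := F) (f' := deriv F)
      (g := g) (fun x _ => (hd x).hasDerivAt) hcF'.continuousOn hgc
    rw [hG, hG] at e2
    rw [Nat.cast_zero, ← e2, hGw]
    refine Eq.trans ?_ ((UnitAddCircle.intervalIntegral_preimage (G 0) ψ).trans h1)
    apply intervalIntegral.integral_congr
    intro x _
    simp only [Function.comp, hg, hGF]
    exact div_mul_cancel₀ _ (hpos x).ne'
  · have key : ∀ x y, Real.log (φ x) - Real.log (φ y) ≤
        P * lam ^ (-α) * dist x y ^ α + (Q / lam + M / lam ^ 2) * dist x y := by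
      intro x y
      obtain ⟨s, t, rfl, rfl, hst⟩ := cp_lift x y
      rw [← hst]
      set E := P * lam ^ (-α) * |s - t| ^ α + (Q / lam + M / lam ^ 2) * |s - t| with hE
      have hle : φ s ≤ Real.exp E * φ t := by
        rw [hφ, hφ, Finset.mul_sum]
        refine Finset.sum_le_sum (fun k _ => ?_)
        have hGk := hGl (s + k) (t + k)
        rw [show s + k - (t + k) = s - t by ring] at hGk
        have hdk := (cp_dist_le (G (s + k)) (G (t + k))).trans hGk
        have b1 := (abs_le.1 (hh (G (s + k)) (G (t + k)))).2
        have b2 := (abs_le.1 (cp_loglip F hF lam M hlam hexp hM (G (s + k)) (G (t + k)))).1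
        have c1 : dist (G (s + k) : UnitAddCircle) (G (t + k)) ^ α ≤ lam ^ (-α) * |s - t| ^ α := by
          refine (Real.rpow_le_rpow dist_nonneg hdk hα.le).trans (le_of_eq ?_)
          rw [Real.div_rpow (abs_nonneg _) hl0.le, Real.rpow_neg hl0.le]
          field_simp
        have c2 := mul_le_mul_of_nonneg_left c1 hP
        have c3 := mul_le_mul_of_nonneg_left hdk hQ
        have c4 := mul_le_mul_of_nonneg_left hGk (div_nonneg hM0 hl0.le)
        have c5 : M / lam * (|s - t| / lam) = M / lam ^ 2 * |s - t| := by field_simp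
        have c6 : Q * (|s - t| / lam) = Q / lam * |s - t| := by ring
        have fin : Real.log (ψ (G (s + k)) / deriv F (G (s + k))) ≤
            E + Real.log (ψ (G (t + k)) / deriv F (G (t + k))) := by
          rw [Real.log_div (hp _).ne' (hpos _).ne', Real.log_div (hp _).ne' (hpos _).ne', hE]
          linarith
        have := Real.exp_le_exp.2 fin
        rwa [Real.exp_add, Real.exp_log (div_pos (hp _) (hpos _)),
          Real.exp_log (div_pos (hp _) (hpos _))] at this
      have := Real.log_le_log (hφp _) hle
      rw [Real.log_mul (Real.exp_pos _).ne' (hφp _).ne', Real.log_exp] at this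
      linarith
    intro x y
    have h2 := key x y
    have h3 := key y x
    rw [dist_comm y x] at h3
    rw [abs_le]
    constructor <;> linarith

theorem coupling_preparation
    (F : ℝ → ℝ) (hF : ContDiff ℝ 2 F)
    (w : ℕ) (hw : 0 < w) (hFw : ∀ x : ℝ, F (x + 1) = F x + w)
    (T : UnitAddCircle → UnitAddCircle) (hT : ∀ x : ℝ, T ↑x = (↑(F x) : UnitAddCircle))
    (lam : ℝ) (hlam : 1 < lam) (hexp : ∀ x : ℝ, lam ≤ deriv F x)
    (nT'' : ℝ) (hnT'' : nT'' = ⨆ x : ℝ, |deriv (deriv F) x|)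
    (Omega : ℝ) (hOmega : Omega = nT'' / (lam * (lam - 1)))
    (T' : UnitAddCircle → ℝ) (hT'lift : ∀ x : ℝ, T' ↑x = deriv F x)
    (L : (UnitAddCircle → ℝ) → (UnitAddCircle → ℝ))
    (hL : ∀ u : UnitAddCircle → ℝ, ∀ x : UnitAddCircle,
      L u x = ∑' y : (T ⁻¹' {x}), u y / T' y)
    (α : ℝ) (hα : 0 < α) (hα1 : α ≤ 1)
    (a K : ℝ) (ha : a = Real.exp (-(Omega + 1)) / 2)
    (hK : K = Real.exp (4 * (Omega + 1))) :
    (∀ B : ℝ, 0 < B → ∀ ψ, memH α B ψ → ∀ n : ℕ,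
        Real.log B / (α * Real.log lam) ≤ (n : ℝ) → memH α (Omega + 1) (L^[n] ψ)) ∧
    (∀ ψ, memH α (Omega + 1) ψ → ∀ x, 2 * a ≤ ψ x) ∧
    (∀ ψ, memH α (Omega + 1) ψ → memH α K (fun x => (ψ x - a) / (1 - a))) := by
  have hM : ∀ x, |deriv (deriv F) x| ≤ nT'' := fun x => hnT'' ▸ cp_bound F hF w hFw x
  have hM0 : 0 ≤ nT'' := (abs_nonneg _).trans (hM 0)
  have hl0 : 0 < lam := by linarith
  have hl1 : 0 < lam - 1 := by linarith
  have hO : 0 ≤ Omega := by rw [hOmega]; positivity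
  have hC : 0 ≤ Omega + 1 := by linarith
  refine ⟨?_, ?_, ?_⟩
  · obtain ⟨G, hG, hGF, hGc, hGl, hGw, hsum⟩ :=
      cp_step F hF w hw hFw T hT lam hlam hexp T' hT'lift
    intro B hB ψ hψ n hn
    have hOm : Omega / lam + nT'' / lam ^ 2 = Omega := by
      rw [hOmega]; field_simp; ring
    have hit : ∀ n : ℕ, cpMem α (B * (lam ^ (-α)) ^ n) Omega (L^[n] ψ) := by
      intro n
      induction n with
      | zero =>
        refine ⟨hψ.1, hψ.2.1, fun x y => ?_⟩
        have h1 := hψ.2.2 x y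
        have h2 : 0 ≤ Omega * dist x y := mul_nonneg hO dist_nonneg
        simp only [pow_zero, mul_one, Function.iterate_zero, id_eq] at *
        linarith
      | succ n ih =>
        rw [Function.iterate_succ_apply']
        have := cp_L F hF w hw lam hlam hexp nT'' hM G hG hGF hGc hGl hGw α hα hα1 _ _
          (by positivity) hO (L^[n] ψ) (L (L^[n] ψ))
          (fun x => by rw [hL, hsum]) ih
        rw [hOm, mul_assoc, ← pow_succ] at this
        exact this
    refine cpMem_memH hα hα1 hO ?_ (hit n)
    have hlog : 0 < Real.log lam := Real.log_pos hlam
    rw [div_le_iff₀ (by positivity)] at hn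
    have : B * (lam ^ (-α)) ^ n ≤ 1 := by
      rw [Real.rpow_def_of_pos hl0, ← Real.exp_nat_mul]
      nth_rewrite 1 [← Real.exp_log hB]
      rw [← Real.exp_add, Real.exp_le_one_iff]
      linarith
    linarith
  · intro ψ hψ x
    have := cp_lower hα hC hψ x
    rw [ha]; linarith
  · intro ψ hψ
    refine cp_part3 hα hC ha ?_ hψ
    have := Real.add_one_le_exp (4 * (Omega + 1))
    rw [hK]; linarith
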